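/- Let F_{μν} be a real antisymmetric 4×4 matrix, and let β ≠ 0 be a real number. Set F := F_{μν}F^{μν}, G := F*_{μν}F^{μν}, and U := 1 + F/(2β²) − G²/(16β⁴), and assume U > 0. Then the Born–Infeld effective metric g^{μν} := (1/(4β²U^{3/2})) [ (β² + F/2) η^{μν} + F^μ{}_λ F^{λν} ] and the tensor g_{μν} := 4√U [ η_{μν} − (1/β²) F_μ{}^λ F_{λν} ] are mutual matrix inverses: g^{μα} g_{αν} = δ^μ_ν. -/

import Mathlib

open scoped BigOperators

noncomputable section

/-- The Minkowski metric η = diag(1,-1,-1,-1) (same components for η_{μν} and η^{μν}). -/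
def η (μ ν : Fin 4) : ℝ := if μ = ν then (if μ = 0 then 1 else -1) else 0

/-- The Levi-Civita symbol ε_{abcd} on four indices, with ε₀₁₂₃ = 1. -/
def lc (a b c d : Fin 4) : ℝ :=
  ∑ σ : Equiv.Perm (Fin 4),
    if σ 0 = a ∧ σ 1 = b ∧ σ 2 = c ∧ σ 3 = d then ((Equiv.Perm.sign σ : ℤ) : ℝ) else 0

/-- The Levi-Civita symbol as a determinant of Kronecker deltas. -/
theorem lc_eq_det (a b c d : Fin 4) :
    lc a b c d =
      (Matrix.of fun i j => if i = ![a, b, c, d] j then 1 else 0 :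
        Matrix (Fin 4) (Fin 4) ℝ).det := by
  rw [Matrix.det_apply, lc]
  refine Finset.sum_congr rfl fun σ _ => ?_
  rw [Fin.prod_univ_four]
  by_cases h0 : σ 0 = a <;> by_cases h1 : σ 1 = b <;> by_cases h2 : σ 2 = c <;>
    by_cases h3 : σ 3 = d <;> simp [h0, h1, h2, h3, Units.smul_def]

theorem det_vandermonde_four (v : Fin 4 → ℝ) :
    (Matrix.vandermonde v).det = (v 1 - v 0) * (v 2 - v 0) * (v 3 - v 0) *
      (v 2 - v 1) * (v 3 - v 1) * (v 3 - v 2) := by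
  simp [Matrix.det_succ_row_zero, Fin.sum_univ_succ, Fin.succAbove, Matrix.vandermonde_apply]
  ring

/-- The Levi-Civita symbol as a Vandermonde product. -/
theorem lc_eq_prod (a b c d : Fin 4) :
    lc a b c d = (((b : ℕ) : ℝ) - (a : ℕ)) * (((c : ℕ) : ℝ) - (a : ℕ)) *
      (((d : ℕ) : ℝ) - (a : ℕ)) * (((c : ℕ) : ℝ) - (b : ℕ)) *
      (((d : ℕ) : ℝ) - (b : ℕ)) * (((d : ℕ) : ℝ) - (c : ℕ)) / 12 := by
  have key : Matrix.vandermonde (fun i => ((![a, b, c, d] i : ℕ) : ℝ)) =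
      (Matrix.of fun i j => if i = ![a, b, c, d] j then 1 else 0 :
        Matrix (Fin 4) (Fin 4) ℝ).transpose * Matrix.vandermonde fun i => ((i : ℕ) : ℝ) := by
    ext i j
    simp [Matrix.mul_apply, Matrix.vandermonde_apply]
  have h := congrArg Matrix.det key
  rw [Matrix.det_mul, Matrix.det_transpose, ← lc_eq_det, det_vandermonde_four,
    det_vandermonde_four] at h
  rw [eq_div_iff (by norm_num)]
  norm_num at h
  exact h.symm

/-- the Born–Infeld effective metric and its claimed covariant form are
mutual matrix inverses. -/
theorem born_infeld_effective_metric_inverse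
    (F : Fin 4 → Fin 4 → ℝ) (hFa : ∀ μ ν, F μ ν = - F ν μ)
    (β : ℝ) (hβ : β ≠ 0)
    -- raised components F^{μν}
    (Fup : Fin 4 → Fin 4 → ℝ)
    (hFup : ∀ μ ν, Fup μ ν = ∑ α, ∑ b, η μ α * η ν b * F α b)
    -- the dual F*_{μν} = ½ ε_{μναβ} F^{αβ}
    (Fdual : Fin 4 → Fin 4 → ℝ)
    (hFdual : ∀ μ ν, Fdual μ ν = (1 / 2) * ∑ α, ∑ b, lc μ ν α b * Fup α b)
    -- invariants F, G and U
    (Fi G U : ℝ)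
    (hFi : Fi = ∑ μ, ∑ ν, F μ ν * Fup μ ν)
    (hG : G = ∑ μ, ∑ ν, Fdual μ ν * Fup μ ν)
    (hU : U = 1 + Fi / (2 * β ^ 2) - G ^ 2 / (16 * β ^ 4))
    (hUpos : 0 < U)
    -- g^{μν} = (1/(4β²U^{3/2}))[(β² + F/2)η^{μν} + F^μ{}_λ F^{λν}]
    (gup gdown : Fin 4 → Fin 4 → ℝ)
    (hgup : ∀ μ ν, gup μ ν =
      (1 / (4 * β ^ 2 * Real.sqrt U ^ 3)) *
        ((β ^ 2 + Fi / 2) * η μ ν + ∑ l, (∑ α, η μ α * F α l) * Fup l ν))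
    -- g_{μν} = 4√U [η_{μν} − (1/β²) F_μ{}^λ F_{λν}]
    (hgdown : ∀ μ ν, gdown μ ν =
      4 * Real.sqrt U *
        (η μ ν - (1 / β ^ 2) * ∑ l, (∑ α, F μ α * η α l) * F l ν)) :
    ∀ μ ν, ∑ α, gup μ α * gdown α ν = if μ = ν then (1 : ℝ) else 0 := by
  have h00 : F 0 0 = 0 := by linarith [hFa 0 0]
  have h11 : F 1 1 = 0 := by linarith [hFa 1 1]
  have h22 : F 2 2 = 0 := by linarith [hFa 2 2]
  have h33 : F 3 3 = 0 := by linarith [hFa 3 3]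
  have hFi' : Fi = 2 * (F 1 2 ^ 2 + F 1 3 ^ 2 + F 2 3 ^ 2
      - F 0 1 ^ 2 - F 0 2 ^ 2 - F 0 3 ^ 2) := by
    simp only [hFi, hFup, Fin.sum_univ_four, η, h00, h11, h22, h33,
      hFa 1 0, hFa 2 0, hFa 3 0, hFa 2 1, hFa 3 1, hFa 3 2, Fin.reduceEq, if_true, if_false]
    ring
  have hup : ∀ μ ν, Fup μ ν = η μ μ * η ν ν * F μ ν := by
    intro μ ν
    simp [hFup, η]
  have hG' : G = -4 * (F 0 1 * F 2 3 - F 0 2 * F 1 3 + F 0 3 * F 1 2) := by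
    simp only [hG, hFdual, hup, Fin.sum_univ_four, lc_eq_prod, η, h00, h11, h22, h33,
      hFa 1 0, hFa 2 0, hFa 3 0, hFa 2 1, hFa 3 1, hFa 3 2, Fin.reduceEq, if_true, if_false]
    norm_num
    ring
  have hs : Real.sqrt U ≠ 0 := (Real.sqrt_pos.mpr hUpos).ne'
  have hpre : 1 / (4 * β ^ 2 * Real.sqrt U ^ 3) * (4 * Real.sqrt U) = 1 / (β ^ 2 * U) := by
    nth_rewrite 3 [← Real.sq_sqrt hUpos.le]
    field_simp
  have hβU : β ^ 4 * U = β ^ 4 + β ^ 2 * Fi / 2 - G ^ 2 / 16 := by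
    rw [hU]
    field_simp
  have hprod : ∀ μ ν, ∑ α, ((β ^ 2 + Fi / 2) * η μ α + ∑ l, (∑ a, η μ a * F a l) * Fup l α) *
      (β ^ 2 * η α ν - ∑ l, (∑ a, F α a * η a l) * F l ν) =
      if μ = ν then β ^ 4 * U else 0 := by
    rw [hβU, hG', hFi']
    intro μ ν
    fin_cases μ <;> fin_cases ν <;>
      simp [hup, Fin.sum_univ_four, η, h00, h11, h22, h33,
        hFa 1 0, hFa 2 0, hFa 3 0, hFa 2 1, hFa 3 1, hFa 3 2] <;> ring
  intro μ ν
  have hterm : ∀ α, gup μ α * gdown α ν = 1 / (β ^ 4 * U) *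
      (((β ^ 2 + Fi / 2) * η μ α + ∑ l, (∑ a, η μ a * F a l) * Fup l α) *
      (β ^ 2 * η α ν - ∑ l, (∑ a, F α a * η a l) * F l ν)) := by
    intro α
    rw [hgup, hgdown, mul_mul_mul_comm, hpre]
    field_simp
  simp_rw [hterm]
  rw [← Finset.mul_sum, hprod]
  have hU0 := hUpos.ne'
  split_ifs
  · field_simp
  · simp
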